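/- The map Ď on ǧ_p defined by Ď(f(z)k) = f'(z)k and Ď(f(z)u⊗tⁿ) = f'(z)u⊗tⁿ − n f(z)u⊗tⁿ⁻¹ for f(z) ∈ ℂ((z)), u ∈ g ∪ g¹ and n ∈ ℤ is a ℂ-linear derivation of ǧ_p viewed as a Lie algebra over ℂ: it is additive, ℂ-linear, and satisfies Ď[x,y] = [Ďx,y] + [x,Ďy] for all x,y ∈ ǧ_p. -/

import Mathlib

/-!
Statement 5 (Proposition 3.10, furthermore part): the map `Ď` on `ǧ_p` defined by
`Ď(f(z)k) = f'(z)k` and `Ď(f(z)u⊗tⁿ) = f'(z)u⊗tⁿ − n f(z)u⊗tⁿ⁻¹` is a ℂ-linear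
derivation of `ǧ_p` viewed as a Lie algebra over ℂ.
-/

/-- The formal derivative on `ℂ((z))`. -/
abbrev LSderiv (f : LaurentSeries ℂ) : LaurentSeries ℂ := LaurentSeries.derivative ℂ f

open scoped TensorProduct

noncomputable section

/-- Scalar actions of `ℂ` and `ℂ((z))` on `ℂ((z))` commute. -/
instance : SMulCommClass ℂ (LaurentSeries ℂ) (LaurentSeries ℂ) where
  smul_comm c f x := by
    change c • (f * x) = f * (c • x)
    rw [← HahnSeries.C_mul_eq_smul, ← HahnSeries.C_mul_eq_smul, mul_left_comm]

/-- The underlying ℂ((z))-vector space of `ǧ_p = (ℂ((z)) ⊗ (g ⊕ g¹) ⊗ ℂ[t,t⁻¹]) ⊕ ℂ((z))k`. -/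
abbrev CpSp (g : Type) [AddCommGroup g] [Module ℂ g] : Type :=
  (ℤ →₀ (LaurentSeries ℂ ⊗[ℂ] (g × g))) × LaurentSeries ℂ

variable {g : Type} [LieRing g] [LieAlgebra ℂ g]

/-- The element `a ⊗ tⁿ` of `ǧ_p` (with `a` in the first copy of `g`). -/
def elCA (a : g) (n : ℤ) : CpSp g :=
  (Finsupp.single n ((1 : LaurentSeries ℂ) ⊗ₜ[ℂ] (a, 0)), 0)

/-- The element `a¹ ⊗ tⁿ` of `ǧ_p` (with `a¹` in the second copy `g¹` of `g`). -/
def elCB (a : g) (n : ℤ) : CpSp g :=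
  (Finsupp.single n ((1 : LaurentSeries ℂ) ⊗ₜ[ℂ] (0, a)), 0)

/-- The central element `k` of `ǧ_p`. -/
def elCK (g : Type) [LieRing g] [LieAlgebra ℂ g] : CpSp g := (0, 1)

/-- The embedding of the polynomial ring `ℂ[z]` into `ℂ((z))` (evaluation at `z`). -/
def polyToL (P : Polynomial ℂ) : LaurentSeries ℂ :=
  Polynomial.aeval (HahnSeries.single (1 : ℤ) (1 : ℂ)) P

/-- `p^{(i)}(z)/i!` as an element of `ℂ((z))`, for `i ∈ ℤ`, interpreted as `0` for `i < 0`. -/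
def hDiv (P : Polynomial ℂ) (i : ℤ) : LaurentSeries ℂ :=
  if 0 ≤ i then polyToL (Polynomial.hasseDeriv i.toNat P) else 0

set_option maxSynthPendingDepth 3

section
variable {R M : Type} [CommRing R] [AddCommGroup M] [Module R M]

theorem aux_m1 (m p : R) (x k : M) :
    -((m + (1 - m)) • x) + 0
      = -(m • (x + ((m - 1) * p) • k)) + -((1 - m) • (x + (m * p) • k)) := by module

theorem aux_m5 (m n h p H : R) (S k : M) :
    -((m + n) • S) + (h * (m - n) * p * (-m - n + 1) * H) • k
      = -(m • (S + (h * (m - 1 - n) * p) • H • k))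
        + -(n • (S + (h * (m - (n - 1)) * p) • H • k)) := by module

theorem aux_m2 (m n : R) (x : M) :
    -((m + n) • x) + 0 = -(m • (x + 0)) + -(n • (x + 0)) := by module

theorem aux_m3 (m n : R) (x : M) : -((m + n) • x) = -(m • x) + -(n • x) := by module

theorem aux_m4 (m n j p q : R) (x y : M) :
    ((j + 1) * p) • x + q • (-((m + n + j) • y)) - -((m + n) • q • y)
      = ((j + 1) * p) • x - (j * q) • y := by module
end

theorem aux_theta_coeff (f : LaurentSeries ℂ) (n : ℤ) :
    (HahnSeries.single (1 : ℤ) (1 : ℂ) * LSderiv f).coeff n = (n : ℂ) * f.coeff n := by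
  rw [HahnSeries.coeff_single_mul, one_mul, LSderiv, LaurentSeries.derivative_apply,
    LaurentSeries.hasseDeriv_coeff]
  simp

theorem aux_deriv_mul (f h : LaurentSeries ℂ) :
    LSderiv (f * h) = LSderiv f * h + f * LSderiv h := by
  have hz : (HahnSeries.single (1 : ℤ) (1 : ℂ) : LaurentSeries ℂ) ≠ 0 := by simp
  apply mul_left_cancel₀ hz
  have e : HahnSeries.single (1 : ℤ) (1 : ℂ) * (LSderiv f * h + f * LSderiv h)
      = (HahnSeries.single (1 : ℤ) (1 : ℂ) * LSderiv f) * h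
        + f * (HahnSeries.single (1 : ℤ) (1 : ℂ) * LSderiv h) := by ring
  rw [e]
  have hs : ∀ f : LaurentSeries ℂ,
      (HahnSeries.single (1 : ℤ) (1 : ℂ) * LSderiv f).support ⊆ f.support := by
    intro f n hn
    rw [HahnSeries.mem_support, aux_theta_coeff] at hn
    exact right_ne_zero_of_mul hn
  ext n
  rw [aux_theta_coeff, HahnSeries.coeff_add, HahnSeries.coeff_mul,
    HahnSeries.coeff_mul_left' f.isPWO_support (hs f),
    HahnSeries.coeff_mul_right' h.isPWO_support (hs h), Finset.mul_sum,
    ← Finset.sum_add_distrib]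
  apply Finset.sum_congr rfl
  intro ij hij
  rw [aux_theta_coeff, aux_theta_coeff]
  have h3 : ij.1 + ij.2 = n := (Finset.mem_antidiagonal.mp hij).2.2
  rw [← h3]
  push_cast
  ring

theorem aux_deriv_poly (Q : Polynomial ℂ) :
    LSderiv (polyToL Q) = polyToL (Polynomial.derivative Q) := by
  induction Q using Polynomial.induction_on' with
  | add p q hp hq =>
    simp only [polyToL, LSderiv, map_add] at *
    rw [hp, hq]
  | monomial n c =>
    have key : ∀ (n : ℕ) (c : ℂ), polyToL (Polynomial.monomial n c)
        = HahnSeries.single (n : ℤ) c := by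
      intro n c
      rw [polyToL, Polynomial.aeval_monomial, HahnSeries.single_pow,
        HahnSeries.algebraMap_apply', PowerSeries.algebraMap_apply, Algebra.algebraMap_self_apply,
        HahnSeries.ofPowerSeries_C]
      simp [HahnSeries.C_apply]
    rw [Polynomial.derivative_monomial, key, key, LSderiv, LaurentSeries.derivative_apply,
      LaurentSeries.hasseDeriv_single]
    cases n with
    | zero => simp
    | succ n => simp [mul_comm]

theorem aux_deriv_hasse (P : Polynomial ℂ) (j : ℕ) :
    LSderiv (polyToL (Polynomial.hasseDeriv j P))
      = ((j : ℂ) + 1) • polyToL (Polynomial.hasseDeriv (j + 1) P) := by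
  rw [aux_deriv_poly, ← Polynomial.hasseDeriv_one]
  have h := LinearMap.congr_fun (Polynomial.hasseDeriv_comp (R := ℂ) 1 j) P
  rw [LinearMap.comp_apply] at h
  rw [h, LinearMap.smul_apply, add_comm 1 j, Nat.choose_one_right, polyToL, polyToL,
    map_nsmul, ← Nat.cast_smul_eq_nsmul ℂ]
  push_cast
  rfl

theorem aux_deriv_hDiv (P : Polynomial ℂ) (i : ℤ) :
    LSderiv (hDiv P i) = ((i : ℂ) + 1) • hDiv P (i + 1) := by
  unfold hDiv
  by_cases hi : 0 ≤ i
  · lift i to ℕ using hi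
    rw [if_pos (by omega), if_pos (by omega), aux_deriv_hasse]
    congr
  · rw [if_neg hi]
    by_cases h1 : i = -1
    · subst h1; simp [LSderiv]
    · rw [if_neg (by omega)]; simp [LSderiv]

theorem aux_C_smul (c : ℂ) (x : CpSp g) :
    c • x = (HahnSeries.C c : LaurentSeries ℂ) • x := by
  have h1 : ∀ y : LaurentSeries ℂ ⊗[ℂ] (g × g),
      c • y = (HahnSeries.C c : LaurentSeries ℂ) • y := by
    intro y
    induction y with
    | zero => simp
    | add a b ha hb => rw [smul_add, smul_add, ha, hb]
    | tmul f u =>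
      rw [TensorProduct.smul_tmul', TensorProduct.smul_tmul', smul_eq_mul,
        HahnSeries.C_mul_eq_smul]
  refine Prod.ext ?_ ?_
  · refine Finsupp.ext fun n => ?_
    exact h1 _
  · change c • x.2 = HahnSeries.C c * x.2
    rw [HahnSeries.C_mul_eq_smul]

theorem aux_span (p : CpSp g → Prop) (h0 : p 0) (hadd : ∀ x y, p x → p y → p (x + y))
    (hsm : ∀ (f : LaurentSeries ℂ) x, p x → p (f • x))
    (hA : ∀ a n, p (elCA a n)) (hB : ∀ a n, p (elCB a n)) (hK : p (elCK g)) (x : CpSp g) :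
    p x := by
  obtain ⟨u, v⟩ := x
  have e : ((u, v) : CpSp g) = (u, 0) + v • elCK g := by
    simp [elCK]
  rw [e]
  refine hadd _ _ ?_ (hsm _ _ hK)
  induction u using Finsupp.induction_linear with
  | zero => exact h0
  | add a b ha hb =>
    have e : ((a + b, 0) : CpSp g) = (a, 0) + (b, 0) := by simp
    rw [e]; exact hadd _ _ (ha (by simp [elCK])) (hb (by simp [elCK]))
  | single n y =>
    clear e
    induction y with
    | zero => rw [Finsupp.single_zero]; exact h0
    | add a b ha hb =>
      have e : ((Finsupp.single n (a + b), 0) : CpSp g)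
        = (Finsupp.single n a, 0) + (Finsupp.single n b, 0) := by simp
      rw [e]; exact hadd _ _ ha hb
    | tmul f w =>
      obtain ⟨a, b⟩ := w
      have e : ((Finsupp.single n (f ⊗ₜ[ℂ] (a, b)), 0) : CpSp g)
        = f • elCA a n + f • elCB b n := by
        unfold elCA elCB
        rw [Prod.smul_mk, Prod.smul_mk, Finsupp.smul_single, Finsupp.smul_single,
          TensorProduct.smul_tmul', TensorProduct.smul_tmul', Prod.mk_add_mk,
          ← Finsupp.single_add, ← TensorProduct.tmul_add]
        simp
      rw [e]
      exact hadd _ _ (hsm _ _ (hA _ _)) (hsm _ _ (hB _ _))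

set_option maxHeartbeats 2000000 in
theorem statement5
    (Φ : g →ₗ[ℂ] g →ₗ[ℂ] ℂ)
    (hsymm : ∀ a b : g, Φ a b = Φ b a)
    (hinv : ∀ a b c : g, Φ ⁅a, b⁆ c = Φ a ⁅b, c⁆)
    (hnondeg : ∀ a : g, (∀ b : g, Φ a b = 0) → a = 0)
    (P : Polynomial ℂ)
    -- the ℂ((z))-bilinear bracket of `ǧ_p`, specified on the generating elements:
    (B : CpSp g →ₗ[LaurentSeries ℂ] CpSp g →ₗ[LaurentSeries ℂ] CpSp g)
    -- `k` is central:
    (hkl : ∀ x : CpSp g, B (elCK g) x = 0)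
    (hkr : ∀ x : CpSp g, B x (elCK g) = 0)
    -- `[a⊗tᵐ, b⊗tⁿ] = [a,b]⊗tᵐ⁺ⁿ + m⟨a,b⟩δ_{m+n,0}k`:
    (haa : ∀ (a b : g) (m n : ℤ),
      B (elCA a m) (elCA b n)
        = elCA ⁅a, b⁆ (m + n)
          + (if m + n = 0 then ((m : ℂ) * Φ a b) • elCK g else 0))
    -- `[a⊗tᵐ, b¹⊗tⁿ] = [a¹⊗tᵐ, b⊗tⁿ] = [a,b]¹⊗tᵐ⁺ⁿ`:
    (hab : ∀ (a b : g) (m n : ℤ), B (elCA a m) (elCB b n) = elCB ⁅a, b⁆ (m + n))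
    (hba : ∀ (a b : g) (m n : ℤ), B (elCB a m) (elCA b n) = elCB ⁅a, b⁆ (m + n))
    -- `[a¹⊗tᵐ, b¹⊗tⁿ] = Σ_{j≥0} (p^{(j)}(z)/j!)[a,b]⊗tᵐ⁺ⁿ⁺ʲ
    --                  + (1/2)(m−n)⟨a,b⟩(p^{(−m−n)}(z)/(−m−n)!)k`:
    (hbb : ∀ (a b : g) (m n : ℤ),
      B (elCB a m) (elCB b n)
        = (∑ j ∈ Finset.range (P.natDegree + 1),
            polyToL (Polynomial.hasseDeriv j P) • elCA ⁅a, b⁆ (m + n + (j : ℤ)))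
          + ((1 / 2 : ℂ) * ((m : ℂ) - (n : ℂ)) * Φ a b) • (hDiv P (-m - n) • elCK g))
    -- the ℂ-linear (in particular additive) map `Ď`, specified on spanning elements:
    (Dc : CpSp g →ₗ[ℂ] CpSp g)
    (hDk : ∀ f : LaurentSeries ℂ, Dc (f • elCK g) = LSderiv f • elCK g)
    (hDa : ∀ (f : LaurentSeries ℂ) (a : g) (n : ℤ),
      Dc (f • elCA a n) = LSderiv f • elCA a n - (n : ℂ) • (f • elCA a (n - 1)))
    (hDb : ∀ (f : LaurentSeries ℂ) (a : g) (n : ℤ),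
      Dc (f • elCB a n) = LSderiv f • elCB a n - (n : ℂ) • (f • elCB a (n - 1))) :
    -- `Ď` is a derivation of `ǧ_p` viewed as a Lie algebra over ℂ:
    ∀ x y : CpSp g, Dc (B x y) = B (Dc x) y + B x (Dc y) := by
  have hone : LSderiv 1 = 0 := by
    have h := aux_deriv_mul 1 1
    simpa using h
  have hL : ∀ (x : CpSp g) (f : LaurentSeries ℂ), Dc (f • x) = LSderiv f • x + f • Dc x := by
    intro x
    induction x using aux_span with
    | h0 => intro f; simp
    | hadd x y hx hy =>
      intro f
      rw [smul_add, map_add, hx, hy, map_add, smul_add, smul_add]; abel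
    | hsm h x hx =>
      intro f
      rw [smul_smul, hx, hx, aux_deriv_mul, add_smul, smul_add, smul_smul, smul_smul, smul_smul]
      abel
    | hA a n =>
      intro f
      have h1 := hDa 1 a n
      rw [one_smul, hone, zero_smul, zero_sub, one_smul] at h1
      rw [hDa, h1, aux_C_smul, aux_C_smul, smul_neg, smul_smul, smul_smul, mul_comm, sub_eq_add_neg]
    | hB a n =>
      intro f
      have h1 := hDb 1 a n
      rw [one_smul, hone, zero_smul, zero_sub, one_smul] at h1
      rw [hDb, h1, aux_C_smul, aux_C_smul, smul_neg, smul_smul, smul_smul, mul_comm, sub_eq_add_neg]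
    | hK =>
      intro f
      have h1 := hDk 1
      rw [one_smul, hone, zero_smul] at h1
      rw [hDk, h1, smul_zero, add_zero]
  have hA1 : ∀ (a : g) (n : ℤ), Dc (elCA a n)
      = -((HahnSeries.C (n : ℂ) : LaurentSeries ℂ) • elCA a (n - 1)) := by
    intro a n
    have h1 := hDa 1 a n
    rwa [one_smul, hone, zero_smul, zero_sub, one_smul, aux_C_smul] at h1
  have hB1 : ∀ (a : g) (n : ℤ), Dc (elCB a n)
      = -((HahnSeries.C (n : ℂ) : LaurentSeries ℂ) • elCB a (n - 1)) := by
    intro a n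
    have h1 := hDb 1 a n
    rwa [one_smul, hone, zero_smul, zero_sub, one_smul, aux_C_smul] at h1
  have hK1 : Dc (elCK g) = 0 := by
    have h1 := hDk 1
    rwa [one_smul, hone, zero_smul] at h1
  have hC : ∀ c : ℂ, LSderiv (HahnSeries.C c) = 0 := by
    intro c
    have h : (HahnSeries.C c : LaurentSeries ℂ) = c • 1 := by
      rw [← HahnSeries.C_mul_eq_smul, mul_one]
    rw [h, LSderiv, map_smul]
    change c • LSderiv 1 = 0
    rw [hone, smul_zero]
  intro x
  induction x using aux_span with
  | h0 => intro y; simp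
  | hadd x x' hx hx' =>
    intro y
    simp only [map_add, LinearMap.add_apply, hx, hx']; abel
  | hsm f x hx =>
    intro y
    simp only [map_add, map_smul, LinearMap.add_apply, LinearMap.smul_apply, hL, hx, smul_add]
    abel
  | hK => intro y; simp [hkl, hK1]
  | hA a m =>
    intro y
    induction y using aux_span with
    | h0 => simp
    | hadd x x' hx hx' => simp only [map_add, hx, hx']; abel
    | hsm f x hx => simp only [map_add, map_smul, hL, hx, smul_add]; abel
    | hK => simp [hkr, hK1]
    | hA b n =>
      rw [haa, hA1, hA1, map_add, hA1, map_neg, LinearMap.neg_apply, map_neg, map_smul, map_smul,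
        LinearMap.smul_apply, haa, haa]
      have e1 : m - 1 + n = m + n - 1 := by ring
      have e2 : m + (n - 1) = m + n - 1 := by ring
      have h0 : Dc (if m + n = 0 then ((m : ℂ) * Φ a b) • elCK g else 0) = 0 := by
        split_ifs
        · rw [map_smul, hK1, smul_zero]
        · simp
      rw [h0, e1, e2]
      split_ifs with h
      · have hn : n = 1 - m := by omega
        subst hn
        simp only [aux_C_smul]
        push_cast
        simp only [map_add, map_sub, map_mul, map_one]
        exact aux_m1 ..
      · push_cast
        simp only [map_add]
        exact aux_m2 ..
    | hB b n =>
      rw [hab, hA1, hB1, hB1, map_neg, LinearMap.neg_apply, map_neg, map_smul, map_smul,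
        LinearMap.smul_apply, hab, hab]
      have e1 : m - 1 + n = m + n - 1 := by ring
      have e2 : m + (n - 1) = m + n - 1 := by ring
      rw [e1, e2]
      push_cast
      simp only [map_add]
      exact aux_m3 ..
  | hB a m =>
    intro y
    induction y using aux_span with
    | h0 => simp
    | hadd x x' hx hx' => simp only [map_add, hx, hx']; abel
    | hsm f x hx => simp only [map_add, map_smul, hL, hx, smul_add]; abel
    | hK => simp [hkr, hK1]
    | hA b n =>
      rw [hba, hA1, hB1, hB1, map_neg, LinearMap.neg_apply, map_neg, map_smul, map_smul,
        LinearMap.smul_apply, hba, hba]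
      have e1 : m - 1 + n = m + n - 1 := by ring
      have e2 : m + (n - 1) = m + n - 1 := by ring
      rw [e1, e2]
      push_cast
      simp only [map_add]
      exact aux_m3 ..
    | hB b n =>
      rw [hbb, hB1, hB1, map_add, map_neg, LinearMap.neg_apply, map_neg, map_smul B, map_smul (B _),
        LinearMap.smul_apply, hbb, hbb]
      have e1 : m - 1 + n = m + n - 1 := by ring
      have e2 : m + (n - 1) = m + n - 1 := by ring
      have e3 : -(m - 1) - n = -m - n + 1 := by ring
      have e4 : -m - (n - 1) = -m - n + 1 := by ring
      rw [e1, e2, e3, e4]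
      have hs : Dc (∑ j ∈ Finset.range (P.natDegree + 1),
            polyToL (Polynomial.hasseDeriv j P) • elCA ⁅a, b⁆ (m + n + (j : ℤ)))
          = -((HahnSeries.C ((m : ℂ) + n) : LaurentSeries ℂ) •
            ∑ j ∈ Finset.range (P.natDegree + 1),
            polyToL (Polynomial.hasseDeriv j P) • elCA ⁅a, b⁆ (m + n - 1 + (j : ℤ))) := by
        rw [map_sum, Finset.smul_sum, ← Finset.sum_neg_distrib]
        let F : ℕ → CpSp g := fun j => (HahnSeries.C (j : ℂ) *
          polyToL (Polynomial.hasseDeriv j P)) • elCA ⁅a, b⁆ (m + n - 1 + (j : ℤ))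
        have hF : ∑ j ∈ Finset.range (P.natDegree + 1), (F (j + 1) - F j) = 0 := by
          rw [Finset.sum_range_sub]
          have : F (P.natDegree + 1) = 0 := by
            simp only [F]
            rw [Polynomial.hasseDeriv_eq_zero_of_lt_natDegree _ _ (Nat.lt_succ_self _)]
            simp [polyToL]
          rw [this]
          simp [F]
        rw [← sub_eq_zero, ← Finset.sum_sub_distrib, ← hF]
        apply Finset.sum_congr rfl
        intro j _
        have e5 : m + n - 1 + ((j + 1 : ℕ) : ℤ) = m + n + j := by push_cast; ring
        have e6 : m + n + (j : ℤ) - 1 = m + n - 1 + j := by ring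
        simp only [F]
        rw [hL, hA1, e5, e6, aux_deriv_hasse, ← HahnSeries.C_mul_eq_smul]
        push_cast
        simp only [map_add, map_one]
        exact aux_m4 ..
      have hc : Dc (((1 / 2 : ℂ) * ((m : ℂ) - (n : ℂ)) * Φ a b) • (hDiv P (-m - n) • elCK g))
          = (HahnSeries.C ((1 / 2 : ℂ) * ((m : ℂ) - (n : ℂ)) * Φ a b * (-m - n + 1)) *
              hDiv P (-m - n + 1)) • elCK g := by
        rw [map_smul, hDk, aux_deriv_hDiv, aux_C_smul, ← HahnSeries.C_mul_eq_smul, smul_smul,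
          ← mul_assoc, ← map_mul]
        push_cast
        rfl
      rw [hs, hc]
      generalize (∑ j ∈ Finset.range (P.natDegree + 1),
            polyToL (Polynomial.hasseDeriv j P) • elCA ⁅a, b⁆ (m + n - 1 + (j : ℤ))) = S
      generalize hDiv P (-m - n + 1) = H
      simp only [aux_C_smul]
      push_cast
      simp only [map_add, map_sub, map_mul, map_one, map_neg]
      exact aux_m5 ..

end
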